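/- arXiv:1205.0768 — 2 statements merged into one kernel-verified Lean document; each statement's English description precedes it below -/
import Mathlib

section
/- Let G be a simple graph on a vertex type V, let t be a vertex of G, and suppose t is adjacent in G to exactly one vertex w (i.e., the neighbor set of t is {w}). Then for every vertex s with s ≠ t, s is reachable from t in G if and only if s is reachable from w in the induced subgraph of G obtained by deleting t. -/
/-- If `w` is the only neighbor of `t`, a walk from `a` to `s ≠ t` yields reachability of `s` in the
graph with `t` deleted, starting from `a`, or from `w` when `a = t`. -/
theorem SimpleGraph.Walk.reachable_induce_ne_of_neighborSet_eq_singleton {V : Type*}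
    {G : SimpleGraph V} {t w : V} (h : G.neighborSet t = {w}) {a s : V} (p : G.Walk a s)
    (hs : s ≠ t) (b : {u | u ≠ t}) (hb : a = b ∨ a = t ∧ (b : V) = w) :
    (G.induce {u | u ≠ t}).Reachable b ⟨s, hs⟩ := by
  have eq_of_adj {x : V} (hx : G.Adj t x) : x = w := by
    rwa [← SimpleGraph.mem_neighborSet, h] at hx
  induction p generalizing b with
  | nil =>
    rcases hb with rfl | ⟨ha, -⟩
    · exact .rfl
    · exact absurd ha hs
  | @cons a c s hac p ih =>
    rcases hb with rfl | ⟨rfl, hbw⟩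
    · by_cases hc : c = t
      · subst hc
        exact ih hs b (Or.inr ⟨rfl, eq_of_adj hac.symm⟩)
      · have hadj : (G.induce {u | u ≠ t}).Adj b ⟨c, hc⟩ := hac
        exact hadj.reachable.trans (ih hs ⟨c, hc⟩ (Or.inl rfl))
    · exact ih hs b (Or.inl ((eq_of_adj hac).trans hbw.symm))

/-- If a sink `t` is attached to the network by a single link, to the unique
neighbor `w`, then any other vertex `s` can reach `t` in `G` iff `s` can reach `w`
in the network with `t` deleted. -/
theorem single_link_sink_reduction {V : Type*} (G : SimpleGraph V) (t w : V)
    (h : G.neighborSet t = {w}) :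
    ∀ (s : V) (hs : s ≠ t),
      G.Reachable t s ↔
        (G.induce {u | u ≠ t}).Reachable
          ⟨w, by
            have hadj : G.Adj t w := by
              rw [← SimpleGraph.mem_neighborSet, h]; exact Set.mem_singleton w
            exact (G.ne_of_adj hadj).symm⟩
          ⟨s, hs⟩ := by
  have hadj : G.Adj t w := by
    rw [← SimpleGraph.mem_neighborSet, h]; exact Set.mem_singleton w
  intro s hs
  constructor
  · rintro ⟨p⟩
    exact p.reachable_induce_ne_of_neighborSet_eq_singleton h hs _ (Or.inr ⟨rfl, rfl⟩)
  · intro hr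
    exact hadj.reachable.trans (hr.map (SimpleGraph.Embedding.induce _).toHom)
end

section
/- Let G be a simple graph on a vertex type V and let v be a vertex of G whose neighbor set is exactly {a, b} with a ≠ b (a degree-2 interconnection between two links in series). Let G' be the graph obtained from G by deleting the vertex v and adding the edge between a and b. Then for any two vertices x and y, both different from v, x and y are reachable from each other in G if and only if they are reachable from each other in G'. -/
/-- A vertex map sending adjacent vertices to reachable ones preserves reachability. -/
theorem SimpleGraph.Reachable.map_of_adj {V W : Type*} {G : SimpleGraph V} {H : SimpleGraph W}
    (f : V → W) (hf : ∀ u w, G.Adj u w → H.Reachable (f u) (f w)) {x y : V}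
    (hxy : G.Reachable x y) : H.Reachable (f x) (f y) := by
  obtain ⟨p⟩ := hxy
  induction p with
  | nil => exact .refl _
  | cons huw _ ih => exact (hf _ _ huw).trans ih

/-- A degree-2 interconnection `v` with neighbor set exactly `{a, b}` (two links in
series) can be deleted, replacing the two series links by a single link between `a`
and `b`, without changing reachability between the remaining vertices. -/
theorem series_link_contraction {V : Type*} (G : SimpleGraph V) (v a b : V)
    (hab : a ≠ b) (h : G.neighborSet v = {a, b}) :
    ∀ (x y : V) (hx : x ≠ v) (hy : y ≠ v),
      G.Reachable x y ↔
        ((G.induce {u | u ≠ v}) ⊔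
          SimpleGraph.fromEdgeSet
            {s((⟨a, by
                  have hadj : G.Adj v a := by
                    rw [← SimpleGraph.mem_neighborSet, h]; exact Set.mem_insert a {b}
                  exact (G.ne_of_adj hadj).symm⟩ : {u | u ≠ v}),
                (⟨b, by
                  have hadj : G.Adj v b := by
                    rw [← SimpleGraph.mem_neighborSet, h]
                    exact Set.mem_insert_of_mem a (Set.mem_singleton b)
                  exact (G.ne_of_adj hadj).symm⟩ : {u | u ≠ v}))}).Reachable
          ⟨x, hx⟩ ⟨y, hy⟩ := by
  intro x y hx hy
  have hv (u : V) : G.Adj v u ↔ u = a ∨ u = b := by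
    rw [← SimpleGraph.mem_neighborSet, h]; rfl
  have hva : G.Adj v a := (hv a).2 (.inl rfl)
  have hvb : G.Adj v b := (hv b).2 (.inr rfl)
  have hav : a ≠ v := hva.ne'
  have hbv : b ≠ v := hvb.ne'
  constructor
  · intro hxy
    classical
    let f : V → {u | u ≠ v} := fun u => if hu : u = v then ⟨a, hav⟩ else ⟨u, hu⟩
    have hfv : f v = ⟨a, hav⟩ := dif_pos rfl
    have hf (u : V) (hu : u ≠ v) : f u = ⟨u, hu⟩ := dif_neg hu
    rw [← hf x hx, ← hf y hy]
    refine hxy.map_of_adj f fun u w huw => ?_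
    have key (t : V) (ht : G.Adj v t) :
        (G.induce {u | u ≠ v} ⊔ SimpleGraph.fromEdgeSet
          {s((⟨a, hav⟩ : {u | u ≠ v}), ⟨b, hbv⟩)}).Reachable (f v) (f t) := by
      rw [hfv, hf t ht.ne']
      rcases (hv t).1 ht with rfl | rfl
      · exact .refl _
      · refine SimpleGraph.Adj.reachable (.inr ?_)
        simpa [SimpleGraph.fromEdgeSet_adj] using hab
    by_cases hu : u = v
    · subst hu
      exact key w huw
    by_cases hw : w = v
    · subst hw
      exact (key u huw.symm).symm
    rw [hf u hu, hf w hw]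
    exact SimpleGraph.Adj.reachable (.inl huw)
  · intro hxy
    refine hxy.map_of_adj Subtype.val fun u w huw => ?_
    have hab' : G.Reachable a b := hva.symm.reachable.trans hvb.reachable
    rcases huw with huw | huw
    · exact SimpleGraph.Adj.reachable huw
    · obtain ⟨he, -⟩ := (SimpleGraph.fromEdgeSet_adj _).1 huw
      rcases Sym2.eq_iff.1 he with ⟨rfl, rfl⟩ | ⟨rfl, rfl⟩
      · exact hab'
      · exact hab'.symm
end
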